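/- Let q : ℝ × ℝ → ℝ be smooth and ζ ∈ ℂ \ {0}. Suppose Φ : ℝ × ℝ → Matrix (Fin 2) (Fin 2) ℂ is differentiable and satisfies ∂_x Φ(x,t) = X(x,t;ζ) · Φ(x,t) and ∂_t Φ(x,t) = T(x,t;ζ) · Φ(x,t) for all (x,t). Then Ψ(x,t) := σ₄ · conj(Φ(−x,−t)) · σ₄ satisfies ∂_x Ψ(x,t) = X(x,t; −conj ζ) · Ψ(x,t) and ∂_t Ψ(x,t) = T(x,t; −conj ζ) · Ψ(x,t) for all (x,t), where conj denotes entrywise complex conjugation. -/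

import Mathlib

/-- `k(z) = (z + δσ q₀²/z)/2`. -/
noncomputable def kfun (δ σ q₀ : ℝ) (z : ℂ) : ℂ :=
  (z + (δ : ℂ) * (σ : ℂ) * (q₀ : ℂ) ^ 2 / z) / 2

/-- `λ(z) = (z − δσ q₀²/z)/2`. -/
noncomputable def lamfun (δ σ q₀ : ℝ) (z : ℂ) : ℂ :=
  (z - (δ : ℂ) * (σ : ℂ) * (q₀ : ℂ) ^ 2 / z) / 2

def pauli1 : Matrix (Fin 2) (Fin 2) ℂ := !![0, 1; 1, 0]

def pauli2 : Matrix (Fin 2) (Fin 2) ℂ := !![0, -Complex.I; Complex.I, 0]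

def pauli3 : Matrix (Fin 2) (Fin 2) ℂ := !![1, 0; 0, -1]

/-- Potential matrix `Q(x,t) = [[0, q(x,t)], [σ q(−x,−t), 0]]`. -/
noncomputable def Qmat (σ : ℝ) (q : ℝ → ℝ → ℝ) (x t : ℝ) : Matrix (Fin 2) (Fin 2) ℂ :=
  !![0, (q x t : ℂ); (σ : ℂ) * (q (-x) (-t) : ℂ), 0]

/-- `Q_x`, the entrywise partial `x`-derivative of `Q`. -/
noncomputable def Qxmat (σ : ℝ) (q : ℝ → ℝ → ℝ) (x t : ℝ) : Matrix (Fin 2) (Fin 2) ℂ :=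
  Matrix.of fun i j => deriv (fun y => Qmat σ q y t i j) x

/-- `Q_{xx}`, the entrywise second partial `x`-derivative of `Q`. -/
noncomputable def Qxxmat (σ : ℝ) (q : ℝ → ℝ → ℝ) (x t : ℝ) : Matrix (Fin 2) (Fin 2) ℂ :=
  Matrix.of fun i j => deriv (fun y => Qxmat σ q y t i j) x

/-- Lax matrix `X(x,t;z) = i k(z) σ₃ + Q(x,t)`. -/
noncomputable def Xlax (δ σ q₀ : ℝ) (q : ℝ → ℝ → ℝ) (x t : ℝ) (z : ℂ) :
    Matrix (Fin 2) (Fin 2) ℂ :=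
  (Complex.I * kfun δ σ q₀ z) • pauli3 + Qmat σ q x t

/-- Lax matrix
`T = (4k² + 2σ q(x,t) q(−x,−t)) X − 2 i k σ₃ Q_x + [Q_x, Q] − Q_{xx}`. -/
noncomputable def Tlax (δ σ q₀ : ℝ) (q : ℝ → ℝ → ℝ) (x t : ℝ) (z : ℂ) :
    Matrix (Fin 2) (Fin 2) ℂ :=
  (4 * kfun δ σ q₀ z ^ 2 + 2 * (σ : ℂ) * (q x t : ℂ) * (q (-x) (-t) : ℂ)) •
      Xlax δ σ q₀ q x t z
    - (2 * Complex.I * kfun δ σ q₀ z) • (pauli3 * Qxmat σ q x t)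
    + (Qxmat σ q x t * Qmat σ q x t - Qmat σ q x t * Qxmat σ q x t)
    - Qxxmat σ q x t

open ComplexConjugate in
theorem aux_k (δ σ q₀ : ℝ) (z : ℂ) : kfun δ σ q₀ (-(conj z)) = - conj (kfun δ σ q₀ z) := by
  simp only [kfun, map_div₀, map_add, map_mul, map_pow, Complex.conj_ofReal, map_ofNat, div_neg]
  ring

noncomputable def auxD (q : ℝ → ℝ → ℝ) (x t : ℝ) : ℂ := deriv (fun y => (q y t : ℂ)) x

noncomputable def auxDD (q : ℝ → ℝ → ℝ) (x t : ℝ) : ℂ := deriv (fun y => auxD q y t) x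

open ComplexConjugate in
theorem auxD_conj (q : ℝ → ℝ → ℝ) (x t : ℝ) : conj (auxD q x t) = auxD q x t := by
  have := deriv.star (f := fun y => (q y t : ℂ)) (x := x)
  simp only [← starRingEnd_apply, Complex.conj_ofReal] at this
  exact this.symm

open ComplexConjugate in
theorem auxDD_conj (q : ℝ → ℝ → ℝ) (x t : ℝ) : conj (auxDD q x t) = auxDD q x t := by
  have := deriv.star (f := fun y => auxD q y t) (x := x)
  simp only [← starRingEnd_apply, auxD_conj] at this
  exact this.symm

theorem aux_Qx (σ : ℝ) (q : ℝ → ℝ → ℝ) (x t : ℝ) :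
    Qxmat σ q x t = !![0, auxD q x t; -(σ : ℂ) * auxD q (-x) (-t), 0] := by
  have h := deriv_comp_neg (fun y => (q y (-t) : ℂ)) x
  ext i j
  fin_cases i <;> fin_cases j <;> simp [Qxmat, Qmat, auxD, h]

theorem aux_Qxx (σ : ℝ) (q : ℝ → ℝ → ℝ) (x t : ℝ) :
    Qxxmat σ q x t = !![0, auxDD q x t; (σ : ℂ) * auxDD q (-x) (-t), 0] := by
  have h := deriv_comp_neg (fun y => auxD q y (-t)) x
  ext i j
  fin_cases i <;> fin_cases j <;> simp [Qxxmat, aux_Qx, auxDD, h]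

theorem aux_X (δ σ q₀ : ℝ) (σ4 : Matrix (Fin 2) (Fin 2) ℂ)
    (hσ4 : (σ = -1 ∧ σ4 = pauli1) ∨ (σ = 1 ∧ σ4 = pauli2))
    (q : ℝ → ℝ → ℝ) (ζ : ℂ) (x t : ℝ) :
    Xlax δ σ q₀ q x t (-(starRingEnd ℂ ζ)) * σ4
      = -(σ4 * (Xlax δ σ q₀ q (-x) (-t) ζ).map (starRingEnd ℂ)) := by
  simp only [Xlax, aux_k]
  generalize kfun δ σ q₀ ζ = k
  rcases hσ4 with ⟨rfl, rfl⟩ | ⟨rfl, rfl⟩ <;> ext i j <;> fin_cases i <;> fin_cases j <;>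
    simp [Qmat, pauli1, pauli2, pauli3, Matrix.vecMul, dotProduct, Fin.sum_univ_two] <;> ring

theorem aux_T (δ σ q₀ : ℝ) (σ4 : Matrix (Fin 2) (Fin 2) ℂ)
    (hσ4 : (σ = -1 ∧ σ4 = pauli1) ∨ (σ = 1 ∧ σ4 = pauli2))
    (q : ℝ → ℝ → ℝ) (ζ : ℂ) (x t : ℝ) :
    Tlax δ σ q₀ q x t (-(starRingEnd ℂ ζ)) * σ4
      = -(σ4 * (Tlax δ σ q₀ q (-x) (-t) ζ).map (starRingEnd ℂ)) := by
  have h2 : starRingEnd ℂ 2 = 2 := map_ofNat _ 2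
  have h4 : starRingEnd ℂ 4 = 4 := map_ofNat _ 4
  simp only [Tlax, Xlax, aux_k, aux_Qx, aux_Qxx]
  generalize kfun δ σ q₀ ζ = k
  rcases hσ4 with ⟨rfl, rfl⟩ | ⟨rfl, rfl⟩ <;> ext i j <;> fin_cases i <;> fin_cases j <;>
    simp [Qmat, pauli1, pauli2, pauli3, Matrix.vecMul, dotProduct, Fin.sum_univ_two, auxD_conj,
      auxDD_conj, h2, h4] <;> ring

theorem aux_deriv (S A B : Matrix (Fin 2) (Fin 2) ℂ) (hS : S * S = 1)
    (hAB : B * S = -(S * A.map (starRingEnd ℂ)))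
    (F : ℝ → Matrix (Fin 2) (Fin 2) ℂ) (x : ℝ)
    (h : ∀ i j, HasDerivAt (fun y => F y i j) ((A * F (-x)) i j) (-x)) (i j : Fin 2) :
    HasDerivAt (fun y => (S * (F (-y)).map (starRingEnd ℂ) * S) i j)
      ((B * (S * (F (-x)).map (starRingEnd ℂ) * S)) i j) x := by
  have h1 : B * (S * (F (-x)).map (starRingEnd ℂ) * S)
      = S * (-(A * F (-x)).map (starRingEnd ℂ)) * S := by
    rw [Matrix.map_mul, ← Matrix.mul_assoc, ← Matrix.mul_assoc, hAB]
    simp [Matrix.mul_assoc]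
  have h2 : ∀ i j, HasDerivAt (fun y => starRingEnd ℂ (F (-y) i j))
      (-(starRingEnd ℂ ((A * F (-x)) i j))) x := by
    intro i j
    have h3 := ((h i j).star).scomp x (hasDerivAt_neg x)
    simpa [Function.comp_def] using h3
  rw [h1]
  generalize A * F (-x) = M at *
  simp only [Matrix.mul_apply, Matrix.map_apply, Matrix.neg_apply, Fin.sum_univ_two]
  exact ((((h2 0 0).const_mul _).add ((h2 1 0).const_mul _)).mul_const _).add
    ((((h2 0 1).const_mul _).add ((h2 1 1).const_mul _)).mul_const _)

/-- First symmetry of solutions of the Lax pair: if `Φ` solves the Lax pair at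
spectral parameter `ζ`, then `Ψ(x,t) = σ₄ conj(Φ(−x,−t)) σ₄` solves it at `−ζ̄`. -/
theorem first_symmetry_of_solutions
    (q₀ δ σ : ℝ) (hq₀ : 0 < q₀) (hδ : δ = 1 ∨ δ = -1) (hσ : σ = 1 ∨ σ = -1)
    (σ4 : Matrix (Fin 2) (Fin 2) ℂ)
    (hσ4 : (σ = -1 ∧ σ4 = pauli1) ∨ (σ = 1 ∧ σ4 = pauli2))
    (q : ℝ → ℝ → ℝ) (hq : ContDiff ℝ (⊤ : ℕ∞) fun p : ℝ × ℝ => q p.1 p.2)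
    (ζ : ℂ) (hζ : ζ ≠ 0)
    (Φ : ℝ → ℝ → Matrix (Fin 2) (Fin 2) ℂ)
    (hx : ∀ (x t : ℝ) (i j : Fin 2),
      HasDerivAt (fun y => Φ y t i j) ((Xlax δ σ q₀ q x t ζ * Φ x t) i j) x)
    (ht : ∀ (x t : ℝ) (i j : Fin 2),
      HasDerivAt (fun s => Φ x s i j) ((Tlax δ σ q₀ q x t ζ * Φ x t) i j) t) :
    ∀ (x t : ℝ) (i j : Fin 2),
      HasDerivAt (fun y => (σ4 * (Φ (-y) (-t)).map (starRingEnd ℂ) * σ4) i j)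
        ((Xlax δ σ q₀ q x t (-(starRingEnd ℂ ζ)) *
          (σ4 * (Φ (-x) (-t)).map (starRingEnd ℂ) * σ4)) i j) x
      ∧ HasDerivAt (fun s => (σ4 * (Φ (-x) (-s)).map (starRingEnd ℂ) * σ4) i j)
        ((Tlax δ σ q₀ q x t (-(starRingEnd ℂ ζ)) *
          (σ4 * (Φ (-x) (-t)).map (starRingEnd ℂ) * σ4)) i j) t := by
  have hS : σ4 * σ4 = 1 := by
    rcases hσ4 with ⟨_, rfl⟩ | ⟨_, rfl⟩ <;> ext i j <;> fin_cases i <;> fin_cases j <;>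
      simp [pauli1, pauli2]
  intro x t i j
  exact ⟨aux_deriv σ4 _ _ hS (aux_X δ σ q₀ σ4 hσ4 q ζ x t) (fun y => Φ y (-t)) x
      (fun i j => hx (-x) (-t) i j) i j,
    aux_deriv σ4 _ _ hS (aux_T δ σ q₀ σ4 hσ4 q ζ x t) (fun s => Φ (-x) s) t
      (fun i j => ht (-x) (-t) i j) i j⟩
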